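/- arXiv:2311.02131 — 3 statements merged into one kernel-verified Lean document; each statement's English description precedes it below -/
import Mathlib

section
/- With the notation of the previous context (W a d-dimensional F_q-vector space, α : W → F injective F_q-linear, S a system of representatives of P(W), β_S = ∏_{w ∈ S} α(w)), for every g ∈ GL(W) one has β_{g(S)} = det(g) · β_S, where g(S) = {g(w) : w ∈ S} is again a system of representatives. -/
/-- `S` is a system of representatives for the projective space
`P(W) = (W \ {0}) / Fˣ`. -/
def IsProjRepSystem (F : Type*) {W : Type*} [Field F] [AddCommGroup W] [Module F W]
    (S : Finset W) : Prop :=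
  (0 : W) ∉ S ∧ ∀ w : W, w ≠ 0 → ∃! s : W, s ∈ S ∧ ∃ c : F, c ≠ 0 ∧ w = c • s

namespace IsProjRepSystem

variable {F M W : Type*} [Field F] [CommMonoid M] [AddCommGroup W] [Module F W]
  {S T : Finset W}

theorem ne_zero (hS : IsProjRepSystem F S) {s : W} (hs : s ∈ S) : s ≠ 0 :=
  fun h => hS.1 (h ▸ hs)

theorem eq_of_smul_eq (hS : IsProjRepSystem F S) {s t : W} (hs : s ∈ S) (ht : t ∈ S)
    {c : F} (hc : c ≠ 0) (h : t = c • s) : t = s :=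
  (hS.2 t (hS.ne_zero ht)).unique ⟨ht, 1, one_ne_zero, (one_smul F t).symm⟩ ⟨hs, c, hc, h⟩

/-- The product of a function that is constant on punctured lines does not depend on the system
of representatives. -/
theorem prod_eq_prod (hS : IsProjRepSystem F S) (hT : IsProjRepSystem F T) {f : W → M}
    (hf : ∀ (c : F) (w : W), c ≠ 0 → f (c • w) = f w) :
    ∏ s ∈ S, f s = ∏ t ∈ T, f t := by
  have key : ∀ s ∈ S, ∃ t ∈ T, ∃ c : F, c ≠ 0 ∧ s = c • t := fun s hs => by
    obtain ⟨t, ⟨ht, h⟩, -⟩ := hT.2 s (hS.ne_zero hs)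
    exact ⟨t, ht, h⟩
  choose r hr c hc h using key
  refine Finset.prod_bij r hr (fun s hs s' hs' e => ?_) (fun t ht => ?_) (fun s hs => ?_)
  · refine hS.eq_of_smul_eq hs' hs (mul_ne_zero (hc s hs) (inv_ne_zero (hc s' hs'))) ?_
    have e' : r s hs = (c s' hs')⁻¹ • s' := by
      rw [e, eq_inv_smul_iff₀ (hc s' hs')]
      exact (h s' hs').symm
    rw [mul_smul, ← e']
    exact h s hs
  · obtain ⟨s, ⟨hs, d, hd, e⟩, -⟩ := hS.2 t (hT.ne_zero ht)
    refine ⟨s, hs, (hT.eq_of_smul_eq (hr s hs) ht (mul_ne_zero hd (hc s hs)) ?_).symm⟩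
    rw [mul_smul, ← h s hs, ← e]
  · conv_lhs => rw [h s hs]
    exact hf _ _ (hc s hs)

theorem map (hS : IsProjRepSystem F S) (g : W ≃ₗ[F] W) :
    IsProjRepSystem F (S.map g.toEquiv.toEmbedding) := by
  refine ⟨fun h => ?_, fun w hw => ?_⟩
  · obtain ⟨s, hs, e⟩ := Finset.mem_map.1 h
    exact hS.ne_zero hs (g.map_eq_zero_iff.1 e)
  · obtain ⟨s, ⟨hs, c, hc, e⟩, hu⟩ := hS.2 (g.symm w) (by simpa using hw)
    refine ⟨g s, ⟨Finset.mem_map_of_mem _ hs, c, hc, ?_⟩, ?_⟩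
    · rw [← map_smul, ← e, g.apply_symm_apply]
    · rintro t ⟨ht, d, hd, e'⟩
      obtain ⟨s', hs', rfl⟩ := Finset.mem_map.1 ht
      refine congrArg g (hu s' ⟨hs', d, hd, ?_⟩)
      rw [e', map_smul]
      exact congrArg (d • ·) (g.symm_apply_apply s')

theorem prod_comp_equiv (hS : IsProjRepSystem F S) (g : W ≃ₗ[F] W) {f : W → M}
    (hf : ∀ (c : F) (w : W), c ≠ 0 → f (c • w) = f w) :
    ∏ s ∈ S, f (g s) = ∏ s ∈ S, f s := by
  rw [hS.prod_eq_prod (hS.map g) hf, Finset.prod_map]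
  rfl

end IsProjRepSystem

section RatioProd

variable {F L W : Type*} [Field F] [Field L] [Algebra F L] [AddCommGroup W] [Module F W]
  {S : Finset W}

/-- A function that is homogeneous of degree one and does not vanish outside the origin. -/
structure IsHomogeneousNonvanishing (F : Type*) {L W : Type*} [Field F] [Field L] [Algebra F L]
    [AddCommGroup W] [Module F W] (f : W → L) : Prop where
  map_smul : ∀ (c : F) (w : W), c ≠ 0 → f (c • w) = algebraMap F L c * f w
  ne_zero : ∀ w : W, w ≠ 0 → f w ≠ 0

/-- The quotient of the products of `f` over `g(S)` and over `S`. -/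
def ratioProd (S : Finset W) (f : W → L) (g : W ≃ₗ[F] W) : L :=
  ∏ s ∈ S, f (g s) / f s

theorem IsHomogeneousNonvanishing.div_smul {f h : W → L} (hf : IsHomogeneousNonvanishing F f)
    (hh : IsHomogeneousNonvanishing F h) (c : F) (w : W) (hc : c ≠ 0) :
    f (c • w) / h (c • w) = f w / h w := by
  rw [hf.map_smul c w hc, hh.map_smul c w hc, mul_div_mul_left]
  simpa using hc

theorem IsHomogeneousNonvanishing.comp_equiv {f : W → L} (hf : IsHomogeneousNonvanishing F f)
    (g : W ≃ₗ[F] W) : IsHomogeneousNonvanishing F (f ∘ g) where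
  map_smul c w hc := by simp [hf.map_smul c _ hc]
  ne_zero w hw := hf.ne_zero _ (by simpa using hw)

theorem ratioProd_one (hS : IsProjRepSystem F S) {f : W → L}
    (hf : IsHomogeneousNonvanishing F f) : ratioProd S f (1 : W ≃ₗ[F] W) = 1 :=
  Finset.prod_eq_one fun s hs => div_self (hf.ne_zero s (hS.ne_zero hs))

theorem ratioProd_mul (hS : IsProjRepSystem F S) {f : W → L}
    (hf : IsHomogeneousNonvanishing F f) (g h : W ≃ₗ[F] W) :
    ratioProd S f (g * h) = ratioProd S f g * ratioProd S f h := by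
  unfold ratioProd
  rw [← hS.prod_comp_equiv h (f := fun w => f (g w) / f w)
    (fun c w hc => (hf.comp_equiv g).div_smul hf c w hc), ← Finset.prod_mul_distrib]
  refine Finset.prod_congr rfl fun s hs => ?_
  have h0 : f (h s) ≠ 0 := (hf.comp_equiv h).ne_zero s (hS.ne_zero hs)
  rw [div_mul_div_cancel₀ h0]
  rfl

/-- `ratioProd` as a homomorphism. -/
def ratioProdHom (hS : IsProjRepSystem F S) {f : W → L}
    (hf : IsHomogeneousNonvanishing F f) : (W ≃ₗ[F] W) →* L where
  toFun := ratioProd S f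
  map_one' := ratioProd_one hS hf
  map_mul' := ratioProd_mul hS hf

/-- `ratioProd` does not depend on the homogeneous function. -/
theorem ratioProd_eq_ratioProd (hS : IsProjRepSystem F S) {f h : W → L}
    (hf : IsHomogeneousNonvanishing F f) (hh : IsHomogeneousNonvanishing F h)
    (g : W ≃ₗ[F] W) : ratioProd S f g = ratioProd S h g := by
  have key := hS.prod_comp_equiv g (f := fun w => f w / h w) (hf.div_smul hh)
  have hf0 := Finset.prod_ne_zero_iff.2 fun s hs => hf.ne_zero s (hS.ne_zero hs)
  have hh0 := Finset.prod_ne_zero_iff.2 fun s hs => hh.ne_zero s (hS.ne_zero hs)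
  have hh1 := Finset.prod_ne_zero_iff.2 fun s hs =>
    (hh.comp_equiv g).ne_zero s (hS.ne_zero hs)
  simp only [Function.comp_apply] at hh1
  simp only [ratioProd, Finset.prod_div_distrib] at key ⊢
  rw [div_eq_div_iff hh1 hh0] at key
  rw [div_eq_div_iff hf0 hh0, key, mul_comm]

theorem LinearMap.card_filter_apply_eq_one [Fintype W] [DecidableEq F] {φ : W →ₗ[F] F} {v : W}
    (hv : φ v = 1) :
    (Finset.univ.filter fun w => φ w = 1).card = Nat.card (LinearMap.ker φ) := by
  rw [← Fintype.card_subtype, ← Nat.card_eq_fintype_card]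
  refine Nat.card_congr ((Equiv.subRight v).subtypeEquiv fun w => ?_)
  simp [hv, sub_eq_zero]

/-- The number of representatives outside a hyperplane. -/
theorem IsProjRepSystem.card_filter_apply_ne_zero [Fintype W] [DecidableEq F]
    (hS : IsProjRepSystem F S) {φ : W →ₗ[F] F} {v : W} (hv : φ v = 1) :
    (S.filter fun s => φ s ≠ 0).card = Nat.card (LinearMap.ker φ) := by
  rw [← LinearMap.card_filter_apply_eq_one hv]
  refine Finset.card_bij (fun s _ => (φ s)⁻¹ • s) (fun s hs => ?_) (fun s hs t ht e => ?_)
    (fun w hw => ?_)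
  · simpa using inv_mul_cancel₀ (Finset.mem_filter.1 hs).2
  · obtain ⟨hs, hs'⟩ := Finset.mem_filter.1 hs
    obtain ⟨ht, ht'⟩ := Finset.mem_filter.1 ht
    refine hS.eq_of_smul_eq ht hs (mul_ne_zero hs' (inv_ne_zero ht')) ?_
    rw [mul_smul, ← e, smul_inv_smul₀ hs']
  · have hw : φ w = 1 := by simpa using hw
    obtain ⟨s, ⟨hs, c, hc, rfl⟩, -⟩ := hS.2 w (by rintro rfl; simp at hw)
    rw [map_smul, smul_eq_mul] at hw
    refine ⟨s, Finset.mem_filter.2 ⟨hs, right_ne_zero_of_mul_eq_one hw⟩, ?_⟩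
    rw [inv_eq_of_mul_eq_one_left hw]

/-- A dilation along a hyperplane with factor `a` has `ratioProd` equal to `a`. -/
theorem ratioProd_of_dilation [Fintype F] [Fintype W] (hS : IsProjRepSystem F S) {f : W → L}
    (hf : IsHomogeneousNonvanishing F f) {φ : W →ₗ[F] F} {v : W} (hv : φ v = 1)
    {g : W ≃ₗ[F] W} {a : F} (ha : a ≠ 0) (hφ : ∀ w, φ (g w) = a * φ w)
    (hg : ∀ w, φ w = 0 → g w = w) :
    ratioProd S f g = algebraMap F L a := by
  classical
  let h : W → L := fun w => if φ w ≠ 0 then algebraMap F L (φ w) else f w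
  have hh : IsHomogeneousNonvanishing F h := by
    refine ⟨fun c w hc => ?_, fun w hw => ?_⟩
    · by_cases hw : φ w = 0 <;> simp [h, hw, hc, hf.map_smul c w hc]
    · by_cases hw' : φ w = 0
      · simpa [h, hw'] using hf.ne_zero w hw
      · simp [h, hw']
  rw [ratioProd_eq_ratioProd hS hf hh]
  have key : ∀ s ∈ S, h (g s) / h s = if φ s ≠ 0 then algebraMap F L a else 1 := fun s hs => by
    by_cases hs' : φ s = 0
    · simp only [hg s hs', hs', ne_eq, not_true_eq_false, if_false]
      exact div_self (hh.ne_zero s (hS.ne_zero hs))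
    · simp [h, hφ, hs', ha]
  rw [ratioProd, Finset.prod_congr rfl key, ← Finset.prod_filter, Finset.prod_const,
    hS.card_filter_apply_ne_zero hv, Nat.card_eq_fintype_card,
    Module.card_eq_pow_finrank (K := F), ← map_pow, FiniteField.pow_card_pow]

/-- An automorphism of order dividing the characteristic has trivial `ratioProd`. -/
theorem ratioProd_of_pow_eq_one (p : ℕ) [Fact p.Prime] [CharP F p] (hS : IsProjRepSystem F S)
    {f : W → L} (hf : IsHomogeneousNonvanishing F f) {g : W ≃ₗ[F] W} (hg : g ^ p = 1) :
    ratioProd S f g = 1 := by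
  have : CharP L p := charP_of_injective_algebraMap (algebraMap F L).injective p
  have h : ratioProdHom hS hf g ^ p = 1 := by rw [← map_pow, hg, map_one]
  refine frobenius_inj L p ?_
  rw [map_one]
  exact h

theorem Matrix.transvection_pow {n R : Type*} [Fintype n] [DecidableEq n] [CommRing R] {i j : n}
    (hij : i ≠ j) (c : R) (k : ℕ) :
    Matrix.transvection i j c ^ k = Matrix.transvection i j (k * c) := by
  induction k with
  | zero => simp
  | succ k ih =>
    rw [pow_succ, ih, Matrix.transvection_mul_transvection_same i j hij]
    push_cast
    ring_nf

theorem ratioProd_eq_det [Fintype F] [Fintype W] (hS : IsProjRepSystem F S) {f : W → L}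
    (hf : IsHomogeneousNonvanishing F f) (g : W ≃ₗ[F] W) :
    ratioProd S f g = algebraMap F L (LinearMap.det (g : W →ₗ[F] W)) := by
  classical
  let χ := ratioProdHom hS hf
  let b := Module.finBasis F W
  let n := Fin (Module.finrank F W)
  have inj : ∀ {g h : W ≃ₗ[F] W},
      LinearMap.toMatrix b b (g : W →ₗ[F] W) = LinearMap.toMatrix b b (h : W →ₗ[F] W) → g = h :=
    fun e => LinearEquiv.toLinearMap_injective ((LinearMap.toMatrix b b).injective e)
  have mat_mul : ∀ g h : W ≃ₗ[F] W, LinearMap.toMatrix b b ((g * h : W ≃ₗ[F] W) : W →ₗ[F] W) =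
      LinearMap.toMatrix b b (g : W →ₗ[F] W) * LinearMap.toMatrix b b (h : W →ₗ[F] W) :=
    fun g h => LinearMap.toMatrix_mul b (g : W →ₗ[F] W) (h : W →ₗ[F] W)
  have mat_one : LinearMap.toMatrix b b ((1 : W ≃ₗ[F] W) : W →ₗ[F] W) = 1 :=
    LinearMap.toMatrix_one b
  have mat_pow : ∀ (g : W ≃ₗ[F] W) (k : ℕ),
      LinearMap.toMatrix b b ((g ^ k : W ≃ₗ[F] W) : W →ₗ[F] W) =
      LinearMap.toMatrix b b (g : W →ₗ[F] W) ^ k := fun g k => by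
    induction k with
    | zero => exact mat_one
    | succ k ih => rw [pow_succ, mat_mul, ih, pow_succ]
  have lift : ∀ M : Matrix n n F, M.det ≠ 0 →
      ∃ g : W ≃ₗ[F] W, LinearMap.toMatrix b b (g : W →ₗ[F] W) = M := fun M hM => by
    refine ⟨LinearEquiv.ofIsUnitDet (v := b) (v' := b) (f := Matrix.toLin b b M) ?_, ?_⟩
    · simpa using hM
    · exact LinearMap.toMatrix_toLin b b M
  have repr_apply : ∀ (g : W ≃ₗ[F] W) (D : n → F),
      LinearMap.toMatrix b b (g : W →ₗ[F] W) = Matrix.diagonal D →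
      ∀ w i, b.repr (g w) i = D i * b.repr w i := fun g D e w i => by
    have := congrFun (LinearMap.toMatrix_mulVec_repr b b (g : W →ₗ[F] W) w) i
    rw [e, Matrix.mulVec_diagonal] at this
    exact this.symm
  have main : ∀ M : Matrix n n F, M.det ≠ 0 → ∀ g : W ≃ₗ[F] W,
      LinearMap.toMatrix b b (g : W →ₗ[F] W) = M → χ g = algebraMap F L M.det := by
    intro M hM
    refine Matrix.diagonal_transvection_induction_of_det_ne_zero
      (fun M => ∀ g : W ≃ₗ[F] W,
        LinearMap.toMatrix b b (g : W →ₗ[F] W) = M → χ g = algebraMap F L M.det) M hM ?_ ?_ ?_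
    · intro D hD
      rw [Matrix.det_diagonal, Finset.prod_ne_zero_iff] at hD
      have step : ∀ (s : Finset n) (g : W ≃ₗ[F] W), LinearMap.toMatrix b b (g : W →ₗ[F] W) =
          Matrix.diagonal (fun i => if i ∈ s then D i else 1) →
          χ g = algebraMap F L (∏ i ∈ s, D i) := by
        intro s
        induction s using Finset.induction_on with
        | empty =>
          intro g hg
          have : g = 1 := inj (by rw [hg, mat_one]; simp)
          simp [this]
        | insert i s his ih =>
          intro g hg
          obtain ⟨g₁, h₁⟩ := lift (Matrix.diagonal fun j => if j = i then D i else 1)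
            (by
              rw [Matrix.det_diagonal, Finset.prod_ne_zero_iff]
              intro j hj
              split_ifs
              exacts [hD i (Finset.mem_univ i), one_ne_zero])
          obtain ⟨g₂, h₂⟩ := lift (Matrix.diagonal fun j => if j ∈ s then D j else 1) (by
            rw [Matrix.det_diagonal, Finset.prod_ne_zero_iff]
            intro j hj
            split_ifs
            exacts [hD j hj, one_ne_zero])
          have e : g = g₁ * g₂ := inj (by
            rw [mat_mul, h₁, h₂, hg, Matrix.diagonal_mul_diagonal]
            congr 1
            ext j
            by_cases hj : j = i
            · subst hj
              simp [his]
            · simp [hj])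
          have h := repr_apply g₁ _ h₁
          have hχ : χ g₁ = algebraMap F L (D i) := by
            refine ratioProd_of_dilation hS hf (φ := b.coord i) (v := b i) (by simp)
              (hD i (Finset.mem_univ i)) (fun w => ?_) (fun w hw => ?_)
            · simpa using h w i
            · refine b.ext_elem fun j => ?_
              rw [h]
              by_cases hj : j = i
              · subst hj
                rw [Module.Basis.coord_apply] at hw
                rw [hw, mul_zero]
              · simp [hj]
          rw [e, map_mul, hχ, ih g₂ h₂, Finset.prod_insert his, map_mul]
      intro g hg
      rw [Matrix.det_diagonal]
      exact step Finset.univ g (by simpa using hg)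
    · rintro ⟨i, j, hij, c⟩ g hg
      obtain ⟨p, hp⟩ := CharP.exists F
      have : Fact p.Prime := ⟨CharP.char_is_prime F p⟩
      rw [Matrix.TransvectionStruct.det, map_one]
      refine ratioProd_of_pow_eq_one p hS hf (inj ?_)
      rw [mat_pow, hg, mat_one, Matrix.TransvectionStruct.toMatrix_mk,
        Matrix.transvection_pow hij, CharP.cast_eq_zero, zero_mul, Matrix.transvection_zero]
    · intro A B hA hB ihA ihB g hg
      obtain ⟨g₁, h₁⟩ := lift A hA
      obtain ⟨g₂, h₂⟩ := lift B hB
      have e : g = g₁ * g₂ := inj (by rw [mat_mul, h₁, h₂, hg])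
      rw [e, map_mul, ihA g₁ h₁, ihB g₂ h₂, Matrix.det_mul, map_mul]
  have hdet := LinearMap.det_toMatrix b (g : W →ₗ[F] W)
  rw [← hdet]
  exact main _ (by rw [hdet]; exact (LinearEquiv.isUnit_det' g).ne_zero) g rfl

end RatioProd

/-- Lemma 2.11(ii): for `g ∈ GL(W)`, `β_{g(S)} = det g · β_S`. -/
theorem betaS_map_eq_det_mul {F L W : Type*} [Field F] [Fintype F] [Field L] [Algebra F L]
    [AddCommGroup W] [Module F W] [Fintype W] [DecidableEq W]
    (α : W →ₗ[F] L) (hα : Function.Injective α)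
    (S : Finset W) (hS : IsProjRepSystem F S)
    (g : W ≃ₗ[F] W) :
    ∏ w ∈ S, α (g w) =
      algebraMap F L (LinearMap.det (g : W →ₗ[F] W)) * ∏ w ∈ S, α w := by
  have hf : IsHomogeneousNonvanishing F (α : W → L) :=
    ⟨fun c w _ => by rw [map_smul, Algebra.smul_def],
      fun w hw => (map_ne_zero_iff α hα).2 hw⟩
  rw [← ratioProd_eq_det hS hf g, ratioProd, Finset.prod_div_distrib, div_mul_cancel₀]
  exact Finset.prod_ne_zero_iff.2 fun s hs => hf.ne_zero s (hS.ne_zero hs)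
end

section
/- Let A be a Dedekind domain with fraction field K, and let M, M' be finitely generated projective A-modules of the same rank r ≥ 1. Then M ≅ M' if and only if det(M) := Λ^r M is isomorphic to det(M') := Λ^r M' as A-modules. -/
open Module

/-- A finitely generated torsion-free module over a Dedekind domain is projective. -/
lemma IsDedekindDomain.projective_of_isTorsionFree {A M : Type*} [CommRing A] [IsDedekindDomain A]
    [AddCommGroup M] [Module A M] [Module.Finite A M] [IsTorsionFree A M] : Projective A M :=
  have := finitePresentation_of_finite A M
  Flat.projective_of_finitePresentation

lemma Ideal.finrank_eq_one_of_ne_bot {A : Type*} [CommRing A] [IsDomain A] [IsNoetherianRing A]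
    {I : Ideal A} (hI : I ≠ ⊥) : finrank A I = 1 := by
  refine le_antisymm ((Submodule.finrank_le I).trans_eq (finrank_self A)) ?_
  have := Submodule.nontrivial_iff_ne_bot.mpr hI
  exact finrank_pos_iff.mpr this

lemma LinearMap.finrank_ker_add_one_of_ne_zero {A M : Type*} [CommRing A] [IsDomain A]
    [IsNoetherianRing A] [AddCommGroup M] [Module A M] [Module.Finite A M] {f : M →ₗ[A] A}
    (hf : f ≠ 0) : finrank A (LinearMap.ker f) + 1 = finrank A M := by
  rw [← (LinearMap.ker f).finrank_quotient_add_finrank, f.quotKerEquivRange.finrank_eq,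
    Ideal.finrank_eq_one_of_ne_bot (I := LinearMap.range f) (by rwa [ne_eq, LinearMap.range_eq_bot]),
    add_comm]

lemma Module.Projective.exists_nonzero_dual {A M : Type*} [CommRing A] [AddCommGroup M]
    [Module A M] [Projective A M] [Nontrivial M] : ∃ f : M →ₗ[A] A, f ≠ 0 := by
  obtain ⟨x, hx⟩ := exists_ne (0 : M)
  obtain ⟨f, hf⟩ := exists_dual_ne_zero A hx
  exact ⟨f, fun h ↦ hf (by simp [h])⟩

lemma LinearMap.nonempty_equiv_ker_prod_of_surjective {A M N : Type*} [CommRing A]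
    [AddCommGroup M] [Module A M] [AddCommGroup N] [Module A N] [Projective A N]
    (f : M →ₗ[A] N) (hf : Function.Surjective f) :
    Nonempty (M ≃ₗ[A] LinearMap.ker f × N) := by
  obtain ⟨g, hg⟩ := f.exists_rightInverse_of_surjective (LinearMap.range_eq_top.mpr hf)
  exact ⟨(((f.exact_subtype_ker_map).splitSurjectiveEquiv
    (LinearMap.ker f).injective_subtype) ⟨g, hg⟩).1⟩

/-- Over a Dedekind domain, every nonzero ideal `J` has a linear image which is coprime to a given
nonzero ideal `I`. -/
lemma IsDedekindDomain.exists_linearMap_add_eq_one {A : Type*} [CommRing A] [IsDedekindDomain A]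
    {I J : Ideal A} (hI : I ≠ ⊥) (hJ : J ≠ ⊥) :
    ∃ β : J →ₗ[A] A, ∃ i ∈ I, ∃ j, i + β j = 1 := by
  obtain ⟨x, hxJ, hx⟩ := J.exists_mem_ne_zero_of_ne_bot hJ
  obtain ⟨C, hC⟩ := Ideal.dvd_span_singleton.mpr hxJ
  have hC0 : C ≠ ⊥ := by
    rintro rfl
    exact hx (by simpa using hC)
  obtain ⟨a, ha⟩ := IsDedekindDomain.exists_sup_span_eq (I := I * C) (J := C) Ideal.mul_le_right
    (mul_ne_zero hI hC0)
  have haC : a ∈ C := ha ▸ Ideal.mem_sup_right (Ideal.mem_span_singleton_self a)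
  have hmem (j : J) : (a • J.subtype) j ∈ A ∙ x := by
    have := Ideal.mul_mem_mul j.2 haC
    rw [← hC] at this
    simpa [mul_comm] using this
  let e := LinearEquiv.toSpanNonzeroSingleton A A x hx
  have he (j : J) : e.symm ((a • J.subtype).codRestrict (A ∙ x) hmem j) * x = a * j :=
    congrArg Subtype.val (e.apply_symm_apply ((a • J.subtype).codRestrict (A ∙ x) hmem j))
  refine ⟨e.symm ∘ₗ (a • J.subtype).codRestrict (A ∙ x) hmem, ?_⟩
  have hxmem : x ∈ I * Ideal.span {x} ⊔ J * Ideal.span {a} := by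
    have : I * Ideal.span {x} ⊔ J * Ideal.span {a} = Ideal.span {x} := by
      rw [hC, mul_left_comm, ← Ideal.mul_sup, ha]
    rw [this]
    exact Ideal.mem_span_singleton_self x
  obtain ⟨y, hy, z, hz, hyz⟩ := Submodule.mem_sup.mp hxmem
  obtain ⟨i, hi, rfl⟩ := Ideal.mem_mul_span_singleton.mp hy
  obtain ⟨j, hj, rfl⟩ := Ideal.mem_mul_span_singleton.mp hz
  refine ⟨i, hi, ⟨j, hj⟩, mul_right_cancel₀ hx ?_⟩
  rw [LinearMap.comp_apply, LinearEquiv.coe_coe]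
  linear_combination he ⟨j, hj⟩ + hyz

/-- A finitely generated torsion-free module of rank at least two over a Dedekind domain admits
a surjective linear functional. -/
lemma IsDedekindDomain.exists_surjective_dual {A M : Type*} [CommRing A] [IsDedekindDomain A]
    [AddCommGroup M] [Module A M] [Module.Finite A M] [IsTorsionFree A M]
    (hM : 2 ≤ finrank A M) : ∃ f : M →ₗ[A] A, Function.Surjective f := by
  have := projective_of_isTorsionFree (A := A) (M := M)
  have : Nontrivial M := finrank_pos_iff (R := A).mp (by lia)
  obtain ⟨f, hf⟩ := Projective.exists_nonzero_dual (A := A) (M := M)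
  have hker := LinearMap.finrank_ker_add_one_of_ne_zero hf
  have : Nontrivial (LinearMap.ker f) := finrank_pos_iff (R := A).mp (by lia)
  have := projective_of_isTorsionFree (A := A) (M := LinearMap.ker f)
  obtain ⟨g, hg⟩ := Projective.exists_nonzero_dual (A := A) (M := LinearMap.ker f)
  obtain ⟨β, i, hi, ⟨-, k, rfl⟩, hij⟩ := exists_linearMap_add_eq_one
    (I := LinearMap.range f) (J := LinearMap.range g)
    (by rwa [ne_eq, LinearMap.range_eq_bot]) (by rwa [ne_eq, LinearMap.range_eq_bot])
  have := projective_of_isTorsionFree (A := A) (M := LinearMap.range f)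
  obtain ⟨e⟩ := f.rangeRestrict.nonempty_equiv_ker_prod_of_surjective f.surjective_rangeRestrict
  have hk : (k : M) ∈ LinearMap.ker f.rangeRestrict := by simp
  let h : M →ₗ[A] A := LinearMap.coprod
    (β ∘ₗ g.rangeRestrict ∘ₗ Submodule.inclusion (LinearMap.ker_rangeRestrict f).le)
    (LinearMap.range f).subtype ∘ₗ e
  refine ⟨h, fun a ↦ ⟨a • e.symm (⟨k, hk⟩, ⟨i, hi⟩), ?_⟩⟩
  have : h (e.symm (⟨k, hk⟩, ⟨i, hi⟩)) = 1 := by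
    rw [← hij, add_comm]
    simp only [h, LinearMap.comp_apply, LinearEquiv.coe_coe, LinearEquiv.apply_symm_apply,
      LinearMap.coprod_apply]
    rfl
  rw [map_smul, this, smul_eq_mul, mul_one]

/-- **Steinitz's theorem**: a finitely generated torsion-free module of rank `n + 1` over a
Dedekind domain is the direct sum of a nonzero ideal and a free module of rank `n`. -/
theorem IsDedekindDomain.exists_equiv_ideal_prod {A M : Type*} [CommRing A] [IsDedekindDomain A]
    [AddCommGroup M] [Module A M] [Module.Finite A M] [IsTorsionFree A M] (n : ℕ)
    (hM : finrank A M = n + 1) :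
    ∃ L : Ideal A, L ≠ ⊥ ∧ Nonempty (M ≃ₗ[A] L × (Fin n → A)) := by
  induction n generalizing M with
  | zero =>
    have := projective_of_isTorsionFree (A := A) (M := M)
    have : Nontrivial M := finrank_pos_iff (R := A).mp (by lia)
    obtain ⟨f, hf⟩ := Projective.exists_nonzero_dual (A := A) (M := M)
    have hker := LinearMap.finrank_ker_add_one_of_ne_zero hf
    have hinj : Function.Injective f := by
      rw [← LinearMap.ker_eq_bot, ← not_ne_iff, ← Submodule.nontrivial_iff_ne_bot,
        ← finrank_pos_iff (R := A)]
      lia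
    exact ⟨LinearMap.range f, by rwa [ne_eq, LinearMap.range_eq_bot],
      ⟨LinearEquiv.ofInjective f hinj ≪≫ₗ (LinearEquiv.prodUnique).symm⟩⟩
  | succ n ih =>
    obtain ⟨f, hf⟩ := exists_surjective_dual (A := A) (M := M) (by lia)
    have hf0 : f ≠ 0 := by
      rintro rfl
      exact zero_ne_one (hf 1).choose_spec
    have hker := LinearMap.finrank_ker_add_one_of_ne_zero hf0
    obtain ⟨L, hL, ⟨e⟩⟩ := ih (M := LinearMap.ker f) (by lia)
    obtain ⟨e'⟩ := f.nonempty_equiv_ker_prod_of_surjective hf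
    exact ⟨L, hL, ⟨e' ≪≫ₗ e.prodCongr (.refl A A) ≪≫ₗ LinearEquiv.prodAssoc A L (Fin n → A) A ≪≫ₗ
      (LinearEquiv.refl A L).prodCongr
        (LinearEquiv.prodComm A _ _ ≪≫ₗ Fin.consLinearEquiv A fun _ ↦ A)⟩⟩

namespace exteriorPower

lemma map_smul_id {R M : Type*} [CommRing R] [AddCommGroup M] [Module R M] (n : ℕ) (c : R) :
    map n (c • LinearMap.id : M →ₗ[R] M) = c ^ n • LinearMap.id := by
  refine linearMap_ext ?_
  ext v : 1
  simpa [map_apply_ιMulti, Function.comp_def] using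
    (ιMulti R n).toMultilinearMap.map_smul_univ (fun _ ↦ c) v

instance isTorsionFree_of_projective {R M : Type*} [CommRing R] [IsDomain R] [AddCommGroup M]
    [Module R M] [Module.Finite R M] [Projective R M] (n : ℕ) : IsTorsionFree R (⋀[R]^n M) := by
  obtain ⟨k, f, hf⟩ := Module.Finite.exists_fin' R M
  obtain ⟨g, hg⟩ := f.exists_rightInverse_of_surjective (LinearMap.range_eq_top.mpr hf)
  exact (map_injective (n := n) f hg).moduleIsTorsionFree _ (map_smul _)

/-- An injection with torsion cokernel induces an injection on exterior powers. -/
lemma map_injective_of_comp_eq_smul_id {R M N : Type*} [CommRing R] [IsDomain R] [AddCommGroup M]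
    [Module R M] [Module.Finite R M] [Projective R M] [AddCommGroup N] [Module R N] (n : ℕ)
    (f : M →ₗ[R] N) (g : N →ₗ[R] M) {c : R} (hc : c ≠ 0) (h : g ∘ₗ f = c • LinearMap.id) :
    Function.Injective (map n f) := by
  have hcomp : map n g ∘ₗ map n f = c ^ n • LinearMap.id := by
    rw [← map_comp, h, map_smul_id]
  intro x y hxy
  have := congrArg (map n g) hxy
  simp only [← LinearMap.comp_apply, hcomp] at this
  exact smul_right_injective _ (pow_ne_zero n hc) this

/-- The linear map from the top exterior power of `M × N`, with `N` free, to `M` given by cofactor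
expansion along the `M`-summand. -/
noncomputable def cofactorExpansion {R N : Type*} (M : Type*) [CommRing R] [AddCommGroup M]
    [Module R M] [AddCommGroup N] [Module R N] {n : ℕ} (b : Basis (Fin n) R N) :
    ⋀[R]^(n + 1) (M × N) →ₗ[R] M :=
  alternatingMapLinearEquiv <| AlternatingMap.alternatizeUncurryFin
    { toFun := fun x : M × N ↦ (b.det.compLinearMap (LinearMap.snd R M N)).smulRight x.1
      map_add' := fun x y ↦ AlternatingMap.ext fun _ ↦ by simp
      map_smul' := fun c x ↦ AlternatingMap.ext fun _ ↦ by simp [smul_smul, mul_comm] }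

lemma cofactorExpansion_ιMulti_cons {R N : Type*} (M : Type*) [CommRing R] [AddCommGroup M]
    [Module R M] [AddCommGroup N] [Module R N] {n : ℕ} (b : Basis (Fin n) R N) (m : M) :
    cofactorExpansion M b (ιMulti R (n + 1) (Fin.cons (m, 0) fun i ↦ (0, b i))) = m := by
  simp [cofactorExpansion, AlternatingMap.alternatizeUncurryFin_apply, Fin.sum_univ_succ,
    Basis.det_self]

/-- The determinant of the direct sum of a nonzero ideal and a free module of rank `n`. -/
theorem nonempty_equiv_ideal_prod {A : Type*} [CommRing A] [IsDedekindDomain A] {L : Ideal A}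
    (hL : L ≠ ⊥) (n : ℕ) : Nonempty ((⋀[A]^(n + 1) (L × (Fin n → A))) ≃ₗ[A] L) := by
  let b := Pi.basisFun A (Fin n)
  have hsurj : Function.Surjective (cofactorExpansion L b) :=
    fun m ↦ ⟨_, cofactorExpansion_ιMulti_cons L b m⟩
  have := IsDedekindDomain.projective_of_isTorsionFree (A := A) (M := L)
  obtain ⟨c, hcL, hc⟩ := L.exists_mem_ne_zero_of_ne_bot hL
  have hinj := map_injective_of_comp_eq_smul_id (n + 1)
    (L.subtype.prodMap (LinearMap.id : (Fin n → A) →ₗ[A] _))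
    ((LinearMap.toSpanSingleton A L ⟨c, hcL⟩).prodMap (c • LinearMap.id)) hc (by
      ext <;> simp [mul_comm])
  have hrank : finrank A (⋀[A]^(n + 1) (L × (Fin n → A))) ≤ 1 := by
    refine (LinearMap.finrank_le_finrank_of_injective hinj).trans_eq ?_
    simp [finrank_eq, add_comm]
  have hdisj := Submodule.disjoint_ker_of_finrank_le (L := ⊤) (cofactorExpansion L b) (by
    rw [Submodule.map_top, LinearMap.range_eq_top.mpr hsurj, finrank_top, finrank_top,
      Ideal.finrank_eq_one_of_ne_bot hL]
    exact hrank)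
  exact ⟨.ofBijective _ ⟨LinearMap.ker_eq_bot.mp (top_disjoint.mp hdisj), hsurj⟩⟩

/-- Linearly equivalent modules have linearly equivalent exterior powers. -/
lemma nonempty_equiv_of_equiv {R M N : Type*} [CommRing R] [AddCommGroup M] [Module R M]
    [AddCommGroup N] [Module R N] (n : ℕ) (e : M ≃ₗ[R] N) :
    Nonempty ((⋀[R]^n M) ≃ₗ[R] (⋀[R]^n N)) :=
  ⟨.ofLinearMap (map n e) (map n e.symm) (by rw [← map_comp]; simp [map_id])
    (by rw [← map_comp]; simp [map_id])⟩

end exteriorPower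

/-- Over a Dedekind domain `A`, two finitely generated projective modules of the same
rank `r ≥ 1` are isomorphic if and only if their determinants (top exterior powers)
`det M = ⋀[A]^r M` are isomorphic. -/
theorem projective_iso_iff_det_iso
    {A : Type*} [CommRing A] [IsDomain A] [IsDedekindDomain A]
    {M M' : Type*} [AddCommGroup M] [Module A M] [AddCommGroup M'] [Module A M']
    [Module.Finite A M] [Module.Projective A M]
    [Module.Finite A M'] [Module.Projective A M']
    (r : ℕ) (hr : 1 ≤ r) (hM : Module.finrank A M = r) (hM' : Module.finrank A M' = r) :
    Nonempty (M ≃ₗ[A] M') ↔ Nonempty ((⋀[A]^r M) ≃ₗ[A] (⋀[A]^r M')) := by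
  refine ⟨fun ⟨e⟩ ↦ exteriorPower.nonempty_equiv_of_equiv r e, fun ⟨d⟩ ↦ ?_⟩
  obtain ⟨n, rfl⟩ : ∃ n, r = n + 1 := ⟨r - 1, by lia⟩
  have : IsTorsionFree A M := Flat.isTorsionFree
  have : IsTorsionFree A M' := Flat.isTorsionFree
  obtain ⟨L, hL, ⟨e⟩⟩ := IsDedekindDomain.exists_equiv_ideal_prod n hM
  obtain ⟨L', hL', ⟨e'⟩⟩ := IsDedekindDomain.exists_equiv_ideal_prod n hM'
  obtain ⟨c⟩ := exteriorPower.nonempty_equiv_of_equiv (n + 1) e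
  obtain ⟨c'⟩ := exteriorPower.nonempty_equiv_of_equiv (n + 1) e'
  obtain ⟨l⟩ := exteriorPower.nonempty_equiv_ideal_prod hL n
  obtain ⟨l'⟩ := exteriorPower.nonempty_equiv_ideal_prod hL' n
  let i : L ≃ₗ[A] L' := l.symm ≪≫ₗ c.symm ≪≫ₗ d ≪≫ₗ c' ≪≫ₗ l'
  exact ⟨e ≪≫ₗ i.prodCongr (.refl A _) ≪≫ₗ e'.symm⟩
end

section
/- Let Λ ⊆ Λ' ⊆ ℂ_∞ be A-lattices of the same rank with Λ' / Λ finite, let e^Λ and e^{Λ'} be their exponential functions, and let P(X) = X ∏'_{λ ∈ Λ'/Λ} (1 − X / e^Λ(λ)) be the monic-linear-term polynomial with simple roots at the finite set e^Λ(Λ'/Λ). Then e^{Λ'}(z) = P(e^Λ(z)) for all z (as an identity of entire functions, equivalently of formal power series). -/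
/-- The exponential function of a "lattice" `S ⊆ L`:
`e^S(z) = z ∏'_{0 ≠ λ ∈ S} (1 − z/λ)`. -/
noncomputable def latticeExp {L : Type*} [NormedField L] (S : Set L) (z : L) : L :=
  z * ∏' l : ↥(S \ {0}), (1 - z / (l : L))

open Filter Topology Polynomial

section NonarchimedeanProducts

variable {ι L : Type*} [NormedField L]

theorem norm_eq_one_of_norm_sub_one_lt [IsUltrametricDist L] {x : L} (hx : ‖x - 1‖ < 1) :
    ‖x‖ = 1 := by
  have h := IsUltrametricDist.norm_add_eq_max_of_norm_ne_norm (x := x - 1) (y := (1 : L))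
    (by rw [norm_one]; exact hx.ne)
  rw [sub_add_cancel, norm_one, max_eq_right hx.le] at h
  exact h

theorem norm_prod_sub_one_le [IsUltrametricDist L] {f : ι → L} {s : Finset ι} {δ : ℝ}
    (h0 : 0 ≤ δ) (h1 : δ < 1) (hf : ∀ i ∈ s, ‖f i - 1‖ ≤ δ) : ‖∏ i ∈ s, f i - 1‖ ≤ δ := by
  classical
  induction s using Finset.induction_on with
  | empty => simpa using h0
  | insert a s ha ih =>
    rw [Finset.prod_insert ha]
    have ha1 := hf a (Finset.mem_insert_self a s)
    have hs := ih fun i hi ↦ hf i (Finset.mem_insert_of_mem hi)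
    have hn : ‖f a‖ = 1 := norm_eq_one_of_norm_sub_one_lt (ha1.trans_lt h1)
    have e : f a * ∏ i ∈ s, f i - 1 = f a * (∏ i ∈ s, f i - 1) + (f a - 1) := by ring
    rw [e]
    refine (IsUltrametricDist.norm_add_le_max _ _).trans (max_le ?_ ha1)
    rwa [norm_mul, hn, one_mul]

/-- A finite set outside of which all factors are close to `1`. -/
theorem exists_finset_norm_sub_one_le {f : ι → L} (hf : Tendsto f cofinite (𝓝 1)) {δ : ℝ}
    (hδ : 0 < δ) : ∃ s : Finset ι, ∀ i ∉ s, ‖f i - 1‖ ≤ δ := by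
  have h : ∀ᶠ i in cofinite, ‖f i - 1‖ ≤ δ := by
    filter_upwards [hf.eventually (Metric.closedBall_mem_nhds (1 : L) hδ)] with i hi
    rwa [← dist_eq_norm]
  have hfin := eventually_cofinite.1 h
  refine ⟨hfin.toFinset, fun i hi ↦ ?_⟩
  by_contra hc
  exact hi (hfin.mem_toFinset.2 hc)

/-- Over a complete nonarchimedean field, a product whose factors tend to `1` converges. -/
theorem multipliable_of_tendsto_cofinite_one_of_ultrametric [CompleteSpace L]
    [IsUltrametricDist L] {f : ι → L} (hf : Tendsto f cofinite (𝓝 1)) : Multipliable f := by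
  classical
  obtain ⟨S, hS⟩ := exists_finset_norm_sub_one_le hf (δ := 1 / 2) (by norm_num)
  have key : ∀ δ : ℝ, 0 < δ → δ < 1 → ∃ s₀ : Finset ι, ∀ s, s₀ ≤ s →
      ‖∏ i ∈ s, f i - ∏ i ∈ s₀, f i‖ ≤ ‖∏ i ∈ S, f i‖ * δ := by
    intro δ h0 h1
    obtain ⟨U, hU⟩ := exists_finset_norm_sub_one_le hf h0
    refine ⟨S ∪ U, fun s hs ↦ ?_⟩
    have e1 : ∏ i ∈ s, f i = (∏ i ∈ s \ (S ∪ U), f i) * ∏ i ∈ S ∪ U, f i :=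
      (Finset.prod_sdiff hs).symm
    have e2 : ∏ i ∈ S ∪ U, f i = (∏ i ∈ (S ∪ U) \ S, f i) * ∏ i ∈ S, f i :=
      (Finset.prod_sdiff Finset.subset_union_left).symm
    have n2 : ‖∏ i ∈ (S ∪ U) \ S, f i‖ = 1 := by
      refine norm_eq_one_of_norm_sub_one_lt
        ((norm_prod_sub_one_le (δ := 1 / 2) (by norm_num) (by norm_num) fun i hi ↦ ?_).trans_lt
          (by norm_num))
      exact hS i (Finset.mem_sdiff.1 hi).2
    have n1 : ‖∏ i ∈ s \ (S ∪ U), f i - 1‖ ≤ δ :=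
      norm_prod_sub_one_le h0.le h1 fun i hi ↦
        hU i fun h ↦ (Finset.mem_sdiff.1 hi).2 (Finset.mem_union_right _ h)
    rw [e1, ← sub_one_mul, norm_mul, e2, norm_mul, n2, one_mul, mul_comm]
    gcongr
  have hc : CauchySeq fun s : Finset ι ↦ ∏ i ∈ s, f i := by
    rw [Metric.cauchySeq_iff']
    intro ε hε
    have hC : 0 < ‖∏ i ∈ S, f i‖ + 1 := by positivity
    obtain ⟨s₀, hs₀⟩ := key (min (1 / 2) (ε / (‖∏ i ∈ S, f i‖ + 1)))
      (lt_min (by norm_num) (by positivity)) ((min_le_left _ _).trans_lt (by norm_num))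
    refine ⟨s₀, fun s hs ↦ ?_⟩
    rw [dist_eq_norm]
    refine (hs₀ s hs).trans_lt ?_
    calc ‖∏ i ∈ S, f i‖ * min (1 / 2) (ε / (‖∏ i ∈ S, f i‖ + 1))
        < (‖∏ i ∈ S, f i‖ + 1) * min (1 / 2) (ε / (‖∏ i ∈ S, f i‖ + 1)) :=
          mul_lt_mul_of_pos_right (lt_add_one _) (lt_min (by norm_num) (by positivity))
      _ ≤ (‖∏ i ∈ S, f i‖ + 1) * (ε / (‖∏ i ∈ S, f i‖ + 1)) := by
          gcongr
          exact min_le_right _ _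
      _ = ε := mul_div_cancel₀ _ hC.ne'
  obtain ⟨a, ha⟩ := cauchySeq_tendsto_of_complete hc
  exact ⟨a, ha⟩

theorem tprod_ne_zero_of_tendsto_cofinite_one_of_ultrametric [CompleteSpace L]
    [IsUltrametricDist L] {f : ι → L} (hf : Tendsto f cofinite (𝓝 1)) (h0 : ∀ i, f i ≠ 0) :
    ∏' i, f i ≠ 0 := by
  classical
  obtain ⟨S, hS⟩ := exists_finset_norm_sub_one_le hf (δ := 1 / 2) (by norm_num)
  have hp : Tendsto (fun s : Finset ι ↦ ∏ i ∈ s, f i) atTop (𝓝 (∏' i, f i)) :=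
    (multipliable_of_tendsto_cofinite_one_of_ultrametric hf).hasProd
  have hn : Tendsto (fun s : Finset ι ↦ ‖∏ i ∈ s, f i‖) atTop (𝓝 ‖∏ i ∈ S, f i‖) := by
    refine tendsto_const_nhds.congr' ?_
    filter_upwards [eventually_ge_atTop S] with s hs
    have n2 : ‖∏ i ∈ s \ S, f i‖ = 1 := by
      refine norm_eq_one_of_norm_sub_one_lt
        ((norm_prod_sub_one_le (δ := 1 / 2) (by norm_num) (by norm_num) fun i hi ↦ ?_).trans_lt
          (by norm_num))
      exact hS i (Finset.mem_sdiff.1 hi).2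
    rw [← Finset.prod_sdiff hs, norm_mul, n2, one_mul]
  have := tendsto_nhds_unique hp.norm hn
  rw [← norm_ne_zero_iff, this, norm_ne_zero_iff]
  exact Finset.prod_ne_zero_iff.2 fun i _ ↦ h0 i

end NonarchimedeanProducts

section FiniteGroups

variable {L : Type*} [Field L]

/-- The monic polynomial function with simple zeros at a finite additive subgroup is additive. -/
theorem prod_add_sub_of_finite_subgroup {W : Finset L} (h0 : (0 : L) ∈ W)
    (hW : ∀ x ∈ W, ∀ y ∈ W, x - y ∈ W) (x y : L) :
    ∏ w ∈ W, (x + y - w) = ∏ w ∈ W, (x - w) + ∏ w ∈ W, (y - w) := by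
  have hcard : 0 < W.card := Finset.card_pos.2 ⟨0, h0⟩
  set c := ∏ w ∈ W, (y - w) with hc
  set f : L[X] := ∏ w ∈ W, (X - C w) with hf
  set g : L[X] := ∏ w ∈ W, (X - C (w - y)) with hg
  have fm : f.Monic := monic_prod_X_sub_C _ _
  have gm : g.Monic := monic_prod_X_sub_C _ _
  have fd : f.degree = W.card := by
    rw [hf, degree_prod]; simp
  have gd : g.degree = W.card := by
    rw [hg, degree_prod]; simp only [degree_X_sub_C, Finset.sum_const, nsmul_one]
  have cd : (C c).degree < f.degree := by
    rw [fd]; exact degree_C_le.trans_lt (by exact_mod_cast hcard)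
  have fcd : (f + C c).degree = f.degree := degree_add_eq_left_of_degree_lt cd
  have key : g = f + C c := by
    refine eq_of_degree_le_of_eval_finset_eq W gd.le (by rw [gd, fcd, fd])
      (by rw [gm.leadingCoeff, (fm.add_of_left cd).leadingCoeff]) fun u hu ↦ ?_
    have hfu : f.eval u = 0 := by
      rw [hf, eval_prod]
      exact Finset.prod_eq_zero hu (by simp)
    rw [eval_add, hfu, eval_C, zero_add, hg, eval_prod, hc]
    refine Finset.prod_bij' (fun w _ ↦ w - u) (fun w _ ↦ w + u)
      (fun w hw ↦ hW w hw u hu) (fun w hw ↦ ?_) (by simp) (by simp) fun w _ ↦ ?_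
    · have := hW w hw _ (hW 0 h0 u hu)
      simpa using this
    · simp only [eval_sub, eval_X, eval_C]; ring
  have := congrArg (eval x) key
  rw [eval_add, eval_C, hf, hg, eval_prod, eval_prod] at this
  simp only [eval_sub, eval_X, eval_C] at this
  rw [← this]
  exact Finset.prod_congr rfl fun w _ ↦ by ring

/-- The composition identity for the exponential polynomials of finite additive groups. -/
theorem mul_prod_one_sub_div_of_finite_index [DecidableEq L] {W W' T : Finset L} (h0 : (0 : L) ∈ W)
    (hW : ∀ x ∈ W, ∀ y ∈ W, x - y ∈ W) (hle : W ⊆ W')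
    (hT : ∀ t ∈ T, ∀ w ∈ W, t - w ∈ W' \ W)
    (hTrep : ∀ y ∈ W' \ W, ∃! t, t ∈ T ∧ t - y ∈ W) (z : L) :
    z * ∏ w ∈ W'.erase 0, (1 - z / w) =
      (z * ∏ w ∈ W.erase 0, (1 - z / w)) *
        ∏ t ∈ T, (1 - (z * ∏ w ∈ W.erase 0, (1 - z / w)) /
          (t * ∏ w ∈ W.erase 0, (1 - t / w))) := by
  have he : ∀ x : L, ∏ w ∈ W, (x - w) =
      (∏ w ∈ W.erase 0, (-w)) * (x * ∏ w ∈ W.erase 0, (1 - x / w)) := by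
    intro x
    rw [← Finset.mul_prod_erase W _ h0, sub_zero, mul_left_comm, ← Finset.prod_mul_distrib]
    congr 1
    refine Finset.prod_congr rfl fun w hw ↦ ?_
    have := Finset.ne_of_mem_erase hw
    field_simp
    ring
  have hc : ∏ w ∈ W.erase 0, (-w) ≠ 0 :=
    Finset.prod_ne_zero_iff.2 fun w hw ↦ neg_ne_zero.2 (Finset.ne_of_mem_erase hw)
  have hsplit : ∏ w ∈ W'.erase 0, (1 - z / w) =
      (∏ w ∈ W' \ W, (1 - z / w)) * ∏ w ∈ W.erase 0, (1 - z / w) := by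
    rw [← Finset.prod_sdiff (Finset.erase_subset_erase 0 hle)]
    congr 2
    ext x
    simp only [Finset.mem_sdiff, Finset.mem_erase]
    refine ⟨fun h ↦ ⟨h.1.2, fun hx ↦ h.2 ⟨h.1.1, hx⟩⟩, fun h ↦ ⟨⟨?_, h.1⟩, fun hx ↦ h.2 hx.2⟩⟩
    rintro rfl
    exact h.2 h0
  have hcosets : ∏ w ∈ W' \ W, (1 - z / w) = ∏ t ∈ T, ∏ w ∈ W, (1 - z / (t - w)) := by
    rw [← Finset.prod_product']
    symm
    refine Finset.prod_bij (fun p _ ↦ p.1 - p.2) ?_ ?_ ?_ fun _ _ ↦ rfl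
    · rintro ⟨t, w⟩ hp
      rw [Finset.mem_product] at hp
      exact hT t hp.1 w hp.2
    · rintro ⟨t, w⟩ hp ⟨t', w'⟩ hp' h
      rw [Finset.mem_product] at hp hp'
      dsimp only at h hp hp'
      have htt : t = t' := (hTrep _ (hT t hp.1 w hp.2)).unique
        ⟨hp.1, by simpa using hp.2⟩ ⟨hp'.1, by rw [h]; simpa using hp'.2⟩
      subst htt
      rw [sub_right_inj.1 h]
    · intro y hy
      obtain ⟨t, ⟨ht, hty⟩, -⟩ := hTrep y hy
      exact ⟨(t, t - y), Finset.mem_product.2 ⟨ht, hty⟩, sub_sub_cancel t y⟩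
  rw [hsplit, mul_left_comm, mul_comm, hcosets]
  congr 1
  refine Finset.prod_congr rfl fun t ht ↦ ?_
  have hne : ∀ w ∈ W, t - w ≠ 0 := by
    intro w hw h
    have := hT t ht w hw
    rw [h, Finset.mem_sdiff] at this
    exact this.2 h0
  have hN : ∏ w ∈ W, (t - w) ≠ 0 := Finset.prod_ne_zero_iff.2 hne
  have hadd := prod_add_sub_of_finite_subgroup h0 hW z (t - z)
  rw [add_sub_cancel] at hadd
  rw [← mul_div_mul_left _ _ hc, ← he, ← he, one_sub_div hN, hadd, add_sub_cancel_left,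
    ← hadd, ← Finset.prod_div_distrib]
  refine Finset.prod_congr rfl fun w hw ↦ ?_
  rw [one_sub_div (hne w hw), sub_right_comm]

end FiniteGroups

section LatticeExp

variable {L : Type*} [NormedField L] {S : Set L}

theorem tendsto_one_sub_div_cofinite
    (hS : ∀ r : ℝ, (S ∩ Metric.closedBall 0 r).Finite) (z : L) :
    Tendsto (fun l : ↥(S \ {0}) ↦ 1 - z / (l : L)) cofinite (𝓝 1) := by
  rw [Metric.tendsto_nhds]
  intro ε hε
  rw [eventually_cofinite]
  refine Set.Finite.subset ((hS (‖z‖ / ε)).preimage Subtype.val_injective.injOn) ?_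
  rintro ⟨l, hl, hl0⟩ h
  refine ⟨hl, ?_⟩
  have hlpos : 0 < ‖l‖ := norm_pos_iff.2 hl0
  simp only [Set.mem_ofPred_eq, dist_eq_norm, sub_sub_cancel_left, norm_neg, norm_div, not_lt] at h
  rw [mem_closedBall_zero_iff, le_div_iff₀ hε]
  rw [le_div_iff₀ hlpos] at h
  linarith

theorem latticeExp_ne_zero [CompleteSpace L] [IsUltrametricDist L]
    (hS : ∀ r : ℝ, (S ∩ Metric.closedBall 0 r).Finite) {z : L} (hz : z ≠ 0) (hzS : z ∉ S) :
    latticeExp S z ≠ 0 := by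
  refine mul_ne_zero hz (tprod_ne_zero_of_tendsto_cofinite_one_of_ultrametric
    (tendsto_one_sub_div_cofinite hS z) ?_)
  rintro ⟨l, hl, hl0⟩ h
  rw [sub_eq_zero, eq_comm, div_eq_one_iff_eq hl0] at h
  exact hzS (h ▸ hl)

/-- `latticeExp` is the limit of the exponential polynomials of the balls of the lattice. -/
theorem tendsto_latticeExp [DecidableEq L] [CompleteSpace L] [IsUltrametricDist L]
    (hS : ∀ r : ℝ, (S ∩ Metric.closedBall 0 r).Finite) (z : L) :
    Tendsto (fun n : ℕ ↦ z * ∏ l ∈ (hS n).toFinset.erase 0, (1 - z / l)) atTop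
      (𝓝 (latticeExp S z)) := by
  classical
  have hp : Tendsto (fun s : Finset ↥(S \ {0}) ↦ ∏ l ∈ s, (1 - z / (l : L))) atTop
      (𝓝 (∏' l : ↥(S \ {0}), (1 - z / (l : L)))) :=
    (multipliable_of_tendsto_cofinite_one_of_ultrametric
      (tendsto_one_sub_div_cofinite hS z)).hasProd
  have hA : Tendsto (fun n : ℕ ↦ ((hS n).toFinset.erase 0).subtype (· ∈ S \ {0})) atTop atTop := by
    refine tendsto_atTop_finset_of_monotone (fun m n hmn ↦ ?_) fun ⟨l, hl, hl0⟩ ↦ ?_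
    · refine Finset.subtype_mono (Finset.erase_subset_erase 0 ?_)
      rw [Set.Finite.toFinset_subset_toFinset]
      exact Set.inter_subset_inter_right _ (Metric.closedBall_subset_closedBall (by simpa using hmn))
    · obtain ⟨n, hn⟩ := exists_nat_ge ‖l‖
      exact ⟨n, by simpa using ⟨hl0, hl, hn⟩⟩
  refine ((hp.comp hA).const_mul z).congr fun n ↦ ?_
  rw [Function.comp_apply, Finset.prod_subtype_of_mem (fun l : L ↦ 1 - z / l)]
  intro x hx
  rw [Finset.mem_erase, Set.Finite.mem_toFinset] at hx
  exact ⟨hx.2.1, hx.1⟩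

end LatticeExp

/-- Let `Λ ⊆ Λ'` be `F_q`-sublattices of a complete nonarchimedean field, with `Λ'`
discrete and `Λ` of finite index in `Λ'`, and let `T` be a set of representatives of
the nonzero cosets of `Λ'/Λ`.  Then
`e^{Λ'}(z) = P(e^Λ(z))` where `P(X) = X ∏_{t ∈ T} (1 − X / e^Λ(t))`. -/
theorem latticeExp_of_finite_index
    {F L : Type*} [Field F] [Fintype F] [NormedField L] [CompleteSpace L] [Algebra F L]
    (hna : ∀ x y : L, ‖x + y‖ ≤ max ‖x‖ ‖y‖)
    (Λ Λ' : Submodule F L) (hle : Λ ≤ Λ')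
    (hdisc : ∀ r : ℝ, ((Λ' : Set L) ∩ Metric.closedBall 0 r).Finite)
    (T : Finset L) (hT : ∀ t ∈ T, t ∈ Λ' ∧ t ∉ Λ)
    (hTrep : ∀ y ∈ Λ', y ∉ Λ → ∃! t : L, t ∈ T ∧ y - t ∈ Λ)
    (z : L) :
    latticeExp (Λ' : Set L) z =
      latticeExp (Λ : Set L) z *
        ∏ t ∈ T, (1 - latticeExp (Λ : Set L) z / latticeExp (Λ : Set L) t) := by
  classical
  have : IsUltrametricDist L :=
    IsUltrametricDist.isUltrametricDist_of_forall_norm_add_le_max_norm hna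
  have hdiscΛ : ∀ r : ℝ, ((Λ : Set L) ∩ Metric.closedBall 0 r).Finite := fun r ↦
    (hdisc r).subset (Set.inter_subset_inter_left _ hle)
  have hsub : ∀ {x y : L} {r : ℝ}, ‖x‖ ≤ r → ‖y‖ ≤ r → ‖x - y‖ ≤ r := fun {x y r} hx hy ↦ by
    rw [sub_eq_add_neg]
    exact (hna x (-y)).trans (max_le hx (by rwa [norm_neg]))
  have hlim : Tendsto (fun n : ℕ ↦ (z * ∏ w ∈ (hdiscΛ n).toFinset.erase 0, (1 - z / w)) *
      ∏ t ∈ T, (1 - (z * ∏ w ∈ (hdiscΛ n).toFinset.erase 0, (1 - z / w)) /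
        (t * ∏ w ∈ (hdiscΛ n).toFinset.erase 0, (1 - t / w)))) atTop
      (𝓝 (latticeExp (Λ : Set L) z *
        ∏ t ∈ T, (1 - latticeExp (Λ : Set L) z / latticeExp (Λ : Set L) t))) := by
    refine (tendsto_latticeExp hdiscΛ z).mul (tendsto_finsetProd _ fun t ht ↦ ?_)
    have ht0 : t ≠ 0 := fun h ↦ (hT t ht).2 (h ▸ Λ.zero_mem)
    exact ((tendsto_latticeExp hdiscΛ z).div (tendsto_latticeExp hdiscΛ t)
      (latticeExp_ne_zero hdiscΛ ht0 (hT t ht).2)).const_sub 1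
  refine tendsto_nhds_unique ((tendsto_latticeExp hdisc z).congr' ?_) hlim
  obtain ⟨N, hN⟩ := exists_nat_ge (∑ t ∈ T, ‖t‖)
  filter_upwards [eventually_ge_atTop N] with n hn
  have hTn : ∀ t ∈ T, ‖t‖ ≤ n := fun t ht ↦
    ((Finset.single_le_sum (fun t _ ↦ norm_nonneg t) ht).trans hN).trans (by exact_mod_cast hn)
  refine mul_prod_one_sub_div_of_finite_index ?_ ?_ ?_ ?_ ?_ z
  · simp
  · simp only [Set.Finite.mem_toFinset, Set.mem_inter_iff, SetLike.mem_coe,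
      mem_closedBall_zero_iff]
    exact fun x hx y hy ↦ ⟨Λ.sub_mem hx.1 hy.1, hsub hx.2 hy.2⟩
  · rw [Set.Finite.toFinset_subset_toFinset]
    exact Set.inter_subset_inter_left _ hle
  · simp only [Finset.mem_sdiff, Set.Finite.mem_toFinset, Set.mem_inter_iff, SetLike.mem_coe,
      mem_closedBall_zero_iff]
    exact fun t ht w hw ↦ ⟨⟨Λ'.sub_mem (hT t ht).1 (hle hw.1), hsub (hTn t ht) hw.2⟩,
      fun h ↦ (hT t ht).2 ((Λ.sub_mem_iff_left hw.1).1 h.1)⟩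
  · simp only [Finset.mem_sdiff, Set.Finite.mem_toFinset, Set.mem_inter_iff, SetLike.mem_coe,
      mem_closedBall_zero_iff]
    rintro y ⟨⟨hy, hyn⟩, hyΛ⟩
    obtain ⟨t, ⟨ht, hty⟩, huniq⟩ := hTrep y hy fun h ↦ hyΛ ⟨h, hyn⟩
    refine ⟨t, ⟨ht, ?_, hsub (hTn t ht) hyn⟩, fun t' ht' ↦ huniq t' ⟨ht'.1, ?_⟩⟩
    · rw [← neg_sub]; exact Λ.neg_mem hty
    · rw [← neg_sub]; exact Λ.neg_mem ht'.2.1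
end
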